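/- Assume that f_{n+1} < 4·p_n for all n ≥ 1. Then for each n ≥ 1 there exist prime numbers p and q with p_{n+1} ≤ p ≤ q and 4·p_n = p + q. -/

import Mathlib

open Filter Pointwise

/-- `nthPrime n` is the `n`-th prime number (1-indexed): `nthPrime 1 = 2`, etc. -/
noncomputable def nthPrime (n : ℕ) : ℕ := Nat.nth Nat.Prime (n - 1)

/-- `S n` is the additive submonoid of `ℕ` generated by the primes `q ≥ nthPrime n`. -/
def S (n : ℕ) : AddSubmonoid ℕ :=
  AddSubmonoid.closure {q : ℕ | q.Prime ∧ nthPrime n ≤ q}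

/-- `frob n` is the Frobenius number of `S n`: the largest natural number not in `S n`. -/
noncomputable def frob (n : ℕ) : ℕ := sSup {m : ℕ | m ∉ S n}

/-- `genus n` is the number of natural numbers not in `S n`. -/
noncomputable def genus (n : ℕ) : ℕ := {m : ℕ | m ∉ S n}.ncard

/-- `atoms n` is the minimal generating set `S n \ {0} \ ((S n \ {0}) + (S n \ {0}))`. -/
def atoms (n : ℕ) : Set ℕ :=
  ((S n : Set ℕ) \ {0}) \ (((S n : Set ℕ) \ {0}) + ((S n : Set ℕ) \ {0}))

/-- `u n` is the largest atom of `S n`. -/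
noncomputable def u (n : ℕ) : ℕ := sSup (atoms n)

/-- `e n` is the embedding dimension of `S n`: the number of atoms. -/
noncomputable def e (n : ℕ) : ℕ := (atoms n).ncard

theorem nthPrime_prime (n : ℕ) : (nthPrime n).Prime :=
  Nat.prime_nth_prime _

theorem nthPrime_lt_nthPrime_succ {n : ℕ} (hn : 1 ≤ n) : nthPrime n < nthPrime (n + 1) :=
  Nat.nth_strictMono Nat.infinite_setOfPred_prime (by omega)

theorem prime_mem_S {n q : ℕ} (hq : q.Prime) (h : nthPrime n ≤ q) : q ∈ S n :=
  AddSubmonoid.subset_closure ⟨hq, h⟩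

theorem bddAbove_compl_S (n : ℕ) : BddAbove {m : ℕ | m ∉ S n} := by
  obtain ⟨q, hq, hqp⟩ := Nat.exists_infinite_primes (nthPrime n + 1)
  have hp := nthPrime_prime n
  have hcop : Nat.Coprime (nthPrime n) q := (Nat.coprime_primes hp hqp).2 (by omega)
  refine ⟨nthPrime n * q - nthPrime n - q, fun m hm => ?_⟩
  by_contra! hlt
  refine hm ?_
  have hsub : ({nthPrime n, q} : Set ℕ) ⊆ S n := by
    rintro x (rfl | rfl)
    · exact prime_mem_S hp le_rfl
    · exact prime_mem_S hqp (by omega)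
  have hF := frobeniusNumber_pair hcop hp.one_lt hqp.one_lt
  exact (AddSubmonoid.closure_le.2 hsub) (by
    by_contra hnot
    exact absurd (hF.2 hnot) (by omega))

theorem mem_S_of_frob_lt {n m : ℕ} (h : frob n < m) : m ∈ S n := by
  by_contra hm
  exact absurd (le_csSup (bddAbove_compl_S n) hm) (not_le.2 h)

/-- An even element of `S n` that is positive and less than `4 * nthPrime n` is a sum of two of the
generating primes, provided these are odd and the element is not itself prime. -/
theorem exists_prime_add_prime_of_mem_S {n m : ℕ} (hm : m ∈ S n) (hpos : 0 < m)
    (hlt : m < 4 * nthPrime n) (heven : Even m) (hprime : ¬ m.Prime) (hodd : 2 < nthPrime n) :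
    ∃ p q : ℕ, p.Prime ∧ q.Prime ∧ nthPrime n ≤ p ∧ p ≤ q ∧ m = p + q := by
  obtain ⟨l, hl, rfl⟩ := AddSubmonoid.exists_multiset_of_mem_closure hm
  have hcard := Multiset.card_nsmul_le_sum (s := l) (a := nthPrime n) fun x hx => (hl x hx).2
  have hcard4 : l.card < 4 :=
    lt_of_mul_lt_mul_right ((smul_eq_mul (Multiset.card l) _ ▸ hcard).trans_lt hlt) (Nat.zero_le _)
  have hodd' : ∀ x ∈ l, Odd x := fun x hx =>
    (hl x hx).1.odd_of_ne_two (by have := (hl x hx).2; omega)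
  obtain h0 | h1 | h2 | h3 : l.card = 0 ∨ l.card = 1 ∨ l.card = 2 ∨ l.card = 3 := by omega
  · simp [Multiset.card_eq_zero.1 h0] at hpos
  · obtain ⟨p, rfl⟩ := Multiset.card_eq_one.1 h1
    exact absurd (by simpa using (hl p (by simp)).1) hprime
  · obtain ⟨p, q, rfl⟩ := Multiset.card_eq_two.1 h2
    obtain ⟨hp, hpn⟩ := hl p (by simp)
    obtain ⟨hq, hqn⟩ := hl q (by simp)
    rcases le_total p q with hpq | hpq
    · exact ⟨p, q, hp, hq, hpn, hpq, by simp⟩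
    · exact ⟨q, p, hq, hp, hqn, hpq, by simp [add_comm]⟩
  · obtain ⟨p, q, r, rfl⟩ := Multiset.card_eq_three.1 h3
    have hsum : Odd (p + (q + r)) :=
      (hodd' p (by simp)).add_even ((hodd' q (by simp)).add_odd (hodd' r (by simp)))
    exact absurd heven (Nat.not_even_iff_odd.2 (by simpa using hsum))

theorem four_p_is_sum_of_two_primes_of_C2
    (h : ∀ n ≥ 1, frob (n + 1) < 4 * nthPrime n) :
    ∀ n ≥ 1, ∃ p q : ℕ, p.Prime ∧ q.Prime ∧ nthPrime (n + 1) ≤ p ∧ p ≤ q ∧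
      4 * nthPrime n = p + q := by
  intro n hn
  have hlt := nthPrime_lt_nthPrime_succ hn
  have hp := nthPrime_prime n
  have htwo := hp.two_le
  exact exists_prime_add_prime_of_mem_S (mem_S_of_frob_lt (h n hn)) (by omega) (by omega)
    (even_iff_two_dvd.2 (by omega)) (Nat.not_prime_mul (by norm_num) hp.one_lt.ne') (by omega)
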